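/- (Theorem 2) Fix an integer $m\ge 3$, constants $c>0$, $\lambda>0$, and a real parameter $a>0$ (playing the role of $c\Vert\boldsymbol\alpha\Vert$). Let $\theta_n$ be given by $\theta_{2r}=0$ and $\theta_{2r+1}=(-1)^r\frac{(1/2)_r}{(m/2)_r}a^{2r}$, and let $\gamma_n$ be defined by $\gamma_1=1$, $\gamma_n=\theta_n+\lambda\sum_{k=1}^{n-1}\gamma_{n-k}\theta_k$ for $n\ge 2$. Define $H(t)=e^{-\lambda t}\sum_{n=0}^{\infty}\frac{\gamma_{n+1}}{n!}t^{n}$ (the series converging for all $t\ge 0$). Then for every real $s>0$, $\int_0^{\infty}e^{-st}H(t)\,dt=\dfrac{F\left(\frac{1}{2},\frac{m-2}{2};\frac{m}{2};\frac{a^2}{(s+\lambda)^2+a^2}\right)}{\sqrt{(s+\lambda)^2+a^2}-\lambda F\left(\frac{1}{2},\frac{m-2}{2};\frac{m}{2};\frac{a^2}{(s+\lambda)^2+a^2}\right)}$. -/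

import Mathlib

/-- Pochhammer symbol `(a)_n = a(a+1)⋯(a+n-1)` for a real `a`. -/
noncomputable def poch (a : ℝ) (n : ℕ) : ℝ := (ascPochhammer ℝ n).eval a

/-- Gauss hypergeometric series `F(α,β;γ;x) = ∑ (α)_l (β)_l / ((γ)_l l!) x^l`. -/
noncomputable def hypF (α β γ x : ℝ) : ℝ :=
  ∑' l : ℕ, (poch α l * poch β l) / (poch γ l * l.factorial) * x ^ l

open MeasureTheory Set Filter Topology intervalIntegral

/-- Exponential generating function `∑ uₙ tⁿ / n!` of a real sequence. -/
noncomputable def expGen (u : ℕ → ℝ) (t : ℝ) : ℝ := ∑' n : ℕ, u n / n.factorial * t ^ n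

lemma norm_expGen_term_le {u : ℕ → ℝ} {C : ℝ} (hu : ∀ n, |u n| ≤ C ^ n) {t R : ℝ}
    (ht : |t| ≤ R) (n : ℕ) : ‖u n / n.factorial * t ^ n‖ ≤ (C * R) ^ n / n.factorial := by
  rw [Real.norm_eq_abs, abs_mul, abs_div, abs_pow, Nat.abs_cast, mul_pow, div_mul_eq_mul_div]
  gcongr
  exact (abs_nonneg _).trans (hu n)
  exact hu n

lemma summable_norm_expGen {u : ℕ → ℝ} {C : ℝ} (hu : ∀ n, |u n| ≤ C ^ n) (t : ℝ) :
    Summable fun n : ℕ => ‖u n / n.factorial * t ^ n‖ :=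
  .of_nonneg_of_le (fun _ => norm_nonneg _) (norm_expGen_term_le hu le_rfl)
    (Real.summable_pow_div_factorial (C * |t|))

lemma continuous_expGen {u : ℕ → ℝ} {C : ℝ} (hu : ∀ n, |u n| ≤ C ^ n) :
    Continuous (expGen u) := by
  rw [continuous_iff_continuousAt]
  intro t
  have h : ContinuousOn (expGen u) (Metric.closedBall 0 (|t| + 1)) := by
    refine continuousOn_tsum (fun n => by fun_prop)
      (Real.summable_pow_div_factorial (C * (|t| + 1))) fun n x hx => ?_
    exact norm_expGen_term_le hu (by simpa using hx) n
  refine h.continuousAt (Metric.closedBall_mem_nhds_of_mem ?_)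
  simp

lemma integral_pow_div_factorial_mul (t : ℝ) (j : ℕ) : ∀ i : ℕ,
    ∫ τ in (0 : ℝ)..t, (τ ^ i / i.factorial) * ((t - τ) ^ j / j.factorial)
      = t ^ (i + j + 1) / (i + j + 1).factorial := by
  induction j with
  | zero =>
    intro i
    simp [integral_pow, Nat.factorial_succ]
    field_simp
  | succ j ih =>
    intro i
    have hd : ∀ τ : ℝ, HasDerivAt
        (fun τ : ℝ => (τ ^ (i + 1) / (i + 1).factorial) * ((t - τ) ^ (j + 1) / (j + 1).factorial))
        ((τ ^ i / i.factorial) * ((t - τ) ^ (j + 1) / (j + 1).factorial)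
          - (τ ^ (i + 1) / (i + 1).factorial) * ((t - τ) ^ j / j.factorial)) τ := by
      intro τ
      have h1 := (hasDerivAt_pow (i + 1) τ).div_const ((i + 1).factorial : ℝ)
      have h2 := (((hasDerivAt_id τ).const_sub t).pow (j + 1)).div_const ((j + 1).factorial : ℝ)
      refine (h1.mul h2).congr_deriv ?_
      simp only [Nat.factorial_succ, id, Nat.add_sub_cancel, Pi.pow_apply]
      push_cast
      field_simp
      ring
    have hc1 : Continuous fun τ : ℝ =>
        (τ ^ i / i.factorial) * ((t - τ) ^ (j + 1) / (j + 1).factorial) := by fun_prop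
    have hc2 : Continuous fun τ : ℝ =>
        (τ ^ (i + 1) / (i + 1).factorial) * ((t - τ) ^ j / j.factorial) := by fun_prop
    have h := integral_eq_sub_of_hasDerivAt (fun τ _ => hd τ)
      ((hc1.sub hc2).intervalIntegrable 0 t)
    rw [integral_sub (hc1.intervalIntegrable _ _) (hc2.intervalIntegrable _ _), ih (i + 1)] at h
    simp only [sub_self, ne_eq, Nat.add_eq_zero_iff, one_ne_zero, and_false, not_false_eq_true,
      zero_pow, zero_div, mul_zero, zero_mul] at h
    rw [sub_eq_zero.mp h]
    congr 2 <;> ring_nf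

lemma hasSum_integral_expGen_mul {u v : ℕ → ℝ} {C : ℝ} (hu : ∀ n, |u n| ≤ C ^ n)
    (hv : ∀ n, |v n| ≤ C ^ n) {t : ℝ} (ht : 0 ≤ t) :
    HasSum (fun n : ℕ => (∑ p ∈ Finset.HasAntidiagonal.antidiagonal n, u p.1 * v p.2) / (n + 1).factorial
      * t ^ (n + 1)) (∫ τ in (0 : ℝ)..t, expGen u τ * expGen v (t - τ)) := by
  have hC : 0 ≤ C := by simpa using (abs_nonneg _).trans (hu 1)
  have key := intervalIntegral.hasSum_integral_of_dominated_convergence (a := 0) (b := t)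
    (μ := volume) (f := fun τ => expGen u τ * expGen v (t - τ))
    (F := fun (n : ℕ) (τ : ℝ) => ∑ p ∈ Finset.HasAntidiagonal.antidiagonal n,
      (u p.1 / p.1.factorial * τ ^ p.1) * (v p.2 / p.2.factorial * (t - τ) ^ p.2))
    (fun n _ => ∑ p ∈ Finset.HasAntidiagonal.antidiagonal n,
      ((C * t) ^ p.1 / p.1.factorial) * ((C * t) ^ p.2 / p.2.factorial)) ?_ ?_ ?_ ?_ ?_
  · refine Eq.subst (motive := fun F : ℕ → ℝ => HasSum F _) (funext fun n => ?_) key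
    rw [intervalIntegral.integral_finsetSum fun p _ => Continuous.intervalIntegrable
      (by fun_prop) _ _, Finset.sum_div, Finset.sum_mul]
    refine Finset.sum_congr rfl fun p hp => ?_
    rw [← Finset.HasAntidiagonal.mem_antidiagonal.1 hp, div_mul_eq_mul_div, mul_div_assoc,
      ← integral_pow_div_factorial_mul, ← intervalIntegral.integral_const_mul]
    refine intervalIntegral.integral_congr fun τ _ => ?_
    ring
  · intro n
    exact (by fun_prop : Continuous _).aestronglyMeasurable
  · refine fun n => .of_forall fun τ hτ => ?_
    rw [uIoc_of_le ht] at hτ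
    refine norm_sum_le_of_le _ fun p _ => ?_
    rw [norm_mul]
    gcongr
    · exact norm_expGen_term_le hu (abs_le.2 ⟨by linarith [hτ.1], hτ.2⟩) _
    · exact norm_expGen_term_le hv (abs_le.2 ⟨by linarith [hτ.2], by linarith [hτ.1]⟩) _
  · refine .of_forall fun τ _ => ?_
    have h := (Real.summable_pow_div_factorial (C * t)).norm
    exact (summable_norm_sum_mul_antidiagonal_of_summable_norm h h).of_norm
  · simp
  · refine .of_forall fun τ _ => ?_
    have h1 := summable_norm_expGen hu τ
    have h2 := summable_norm_expGen hv (t - τ)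
    rw [expGen, expGen, tsum_mul_tsum_eq_tsum_sum_antidiagonal_of_summable_norm h1 h2]
    exact (summable_norm_sum_mul_antidiagonal_of_summable_norm h1 h2).of_norm.hasSum

lemma expGen_eq_add_integral {u v : ℕ → ℝ} {C lam : ℝ} (hu : ∀ n, |u n| ≤ C ^ n)
    (hv : ∀ n, |v n| ≤ C ^ n) (h0 : u 0 = v 0)
    (hrec : ∀ n, u (n + 1) = v (n + 1) + lam * ∑ p ∈ Finset.HasAntidiagonal.antidiagonal n, u p.1 * v p.2)
    {t : ℝ} (ht : 0 ≤ t) :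
    expGen u t = expGen v t + lam * ∫ τ in (0 : ℝ)..t, expGen u τ * expGen v (t - τ) := by
  have hsu := (summable_norm_expGen hu t).of_norm
  have hsv := (summable_norm_expGen hv t).of_norm
  rw [expGen, expGen, hsu.tsum_eq_zero_add, hsv.tsum_eq_zero_add, h0, add_assoc,
    ← (hasSum_integral_expGen_mul hu hv ht).tsum_eq, ← tsum_mul_left,
    ← ((summable_nat_add_iff 1).2 hsv).tsum_add
      ((hasSum_integral_expGen_mul hu hv ht).summable.mul_left lam)]
  congr 2
  ext n
  rw [hrec]
  ring

lemma abs_le_exp_of_renewal {g f : ℝ → ℝ} {lam : ℝ} (hlam : 0 < lam) (hg : Continuous g)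
    (hf1 : ∀ t, |f t| ≤ 1)
    (h : ∀ t, 0 ≤ t → g t = f t + lam * ∫ τ in (0 : ℝ)..t, g τ * f (t - τ)) {t : ℝ} (ht : 0 ≤ t) :
    |g t| ≤ Real.exp (lam * t) := by
  have hle : ∀ t, 0 ≤ t → |g t| ≤ 1 + lam * ∫ τ in (0 : ℝ)..t, |g τ| := by
    intro t ht
    have h1 : |∫ τ in (0 : ℝ)..t, g τ * f (t - τ)| ≤ ∫ τ in (0 : ℝ)..t, |g τ| := by
      rw [← Real.norm_eq_abs]
      refine norm_integral_le_of_norm_le ht (.of_forall fun τ _ => ?_)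
        (hg.abs.intervalIntegrable _ _)
      rw [Real.norm_eq_abs, abs_mul]
      exact mul_le_of_le_one_right (abs_nonneg _) (hf1 _)
    rw [h t ht]
    refine (abs_add_le _ _).trans (add_le_add (hf1 t) ?_)
    rw [abs_mul, abs_of_pos hlam]
    gcongr
  have hd : ∀ x, HasDerivAt (fun x => ∫ τ in (0 : ℝ)..x, |g τ|) |g x| x := fun x =>
    integral_hasDerivAt_right (hg.abs.intervalIntegrable _ _)
      (hg.abs.stronglyMeasurableAtFilter _ _) hg.abs.continuousAt
  have hnn : ∀ x, 0 ≤ x → 0 ≤ ∫ τ in (0 : ℝ)..x, |g τ| := fun x hx =>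
    integral_nonneg hx fun _ _ => abs_nonneg _
  have := norm_le_gronwallBound_of_norm_deriv_right_le (a := 0) (b := t) (δ := 0) (K := lam)
    (ε := 1) (f := fun x => ∫ τ in (0 : ℝ)..x, |g τ|) (f' := fun x => |g x|)
    (fun x _ => (hd x).continuousAt.continuousWithinAt) (fun x _ => (hd x).hasDerivWithinAt)
    (by simp) (fun x hx => by
      rw [Real.norm_eq_abs, abs_abs, Real.norm_of_nonneg (hnn x hx.1), add_comm]
      exact hle x hx.1) t ⟨ht, le_rfl⟩
  rw [gronwallBound_of_K_ne_0 hlam.ne', Real.norm_of_nonneg (hnn t ht)] at this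
  refine (hle t ht).trans ?_
  have h2 := mul_le_mul_of_nonneg_left this hlam.le
  simp only [sub_zero, zero_mul, zero_add] at h2
  rw [← mul_assoc, mul_one_div_cancel hlam.ne', one_mul] at h2
  linarith

lemma laplace_renewal {g f : ℝ → ℝ} {lam p : ℝ} (hlam : 0 < lam) (hp : lam < p)
    (hg : Continuous g) (hf : Continuous f) (hf1 : ∀ t, |f t| ≤ 1)
    (h : ∀ t, 0 ≤ t → g t = f t + lam * ∫ τ in (0 : ℝ)..t, g τ * f (t - τ)) :
    (∫ t in Ioi (0 : ℝ), Real.exp (-p * t) * g t) =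
      (∫ t in Ioi (0 : ℝ), Real.exp (-p * t) * f t) /
        (1 - lam * ∫ t in Ioi (0 : ℝ), Real.exp (-p * t) * f t) := by
  have hif : IntegrableOn (fun t => Real.exp (-p * t) * f t) (Ioi 0) := by
    refine (integrableOn_exp_mul_Ioi (a := -p) (by linarith) 0).mono'
      (by fun_prop) (.of_forall fun t => ?_)
    rw [norm_mul, Real.norm_of_nonneg (Real.exp_nonneg _)]
    exact mul_le_of_le_one_right (Real.exp_nonneg _) (hf1 t)
  have hig : IntegrableOn (fun t => Real.exp (-p * t) * g t) (Ioi 0) := by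
    refine (integrableOn_exp_mul_Ioi (a := lam - p) (by linarith) 0).mono'
      (by fun_prop) ((ae_restrict_iff' measurableSet_Ioi).2 (.of_forall fun t ht => ?_))
    rw [norm_mul, Real.norm_of_nonneg (Real.exp_nonneg _), sub_eq_add_neg, add_comm, add_mul,
      Real.exp_add]
    gcongr
    exact abs_le_exp_of_renewal hlam hg hf1 h (le_of_lt ht)
  have hconv := integral_posConvolution hig hif (ContinuousLinearMap.mul ℝ ℝ)
  have hiconv := integrable_posConvolution hig hif (ContinuousLinearMap.mul ℝ ℝ)
  rw [posConvolution, integrable_indicator_iff measurableSet_Ioi] at hiconv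
  simp only [ContinuousLinearMap.mul_apply'] at hconv hiconv
  have heq : (∫ t in Ioi (0 : ℝ), Real.exp (-p * t) * g t)
      = (∫ t in Ioi (0 : ℝ), Real.exp (-p * t) * f t)
        + lam * ((∫ t in Ioi (0 : ℝ), Real.exp (-p * t) * g t)
          * ∫ t in Ioi (0 : ℝ), Real.exp (-p * t) * f t) := by
    rw [← hconv, ← MeasureTheory.integral_const_mul,
      ← MeasureTheory.integral_add hif (hiconv.const_mul lam)]
    refine setIntegral_congr_fun measurableSet_Ioi fun t ht => ?_
    rw [h t (le_of_lt ht), mul_add, mul_left_comm, ← intervalIntegral.integral_const_mul]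
    congr 3
    ext τ
    rw [mul_mul_mul_comm, ← Real.exp_add]
    ring_nf
  have hne : 1 - lam * (∫ t in Ioi (0 : ℝ), Real.exp (-p * t) * f t) ≠ 0 := by
    intro h0
    have : (∫ t in Ioi (0 : ℝ), Real.exp (-p * t) * f t) = 0 := by
      linear_combination (∫ t in Ioi (0 : ℝ), Real.exp (-p * t) * g t) * h0 - heq
    rw [this] at h0
    norm_num at h0
  rw [eq_div_iff hne]
  linear_combination heq

lemma poch_zero (x : ℝ) : poch x 0 = 1 := by simp [poch]

lemma poch_succ (x : ℝ) (n : ℕ) : poch x (n + 1) = poch x n * (x + n) :=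
  ascPochhammer_succ_eval n x

lemma poch_pos {x : ℝ} (hx : 0 < x) (n : ℕ) : 0 < poch x n :=
  ascPochhammer_pos n x hx

lemma integral_sin_pow_mul_cos_pow_succ (N r : ℕ) :
    (N + 2 * r + 2 : ℝ) * ∫ x in (0 : ℝ)..Real.pi, Real.sin x ^ N * Real.cos x ^ (2 * (r + 1))
      = (2 * r + 1) * ∫ x in (0 : ℝ)..Real.pi, Real.sin x ^ N * Real.cos x ^ (2 * r) := by
  have hd : ∀ x : ℝ, HasDerivAt (fun x => Real.sin x ^ (N + 1) * Real.cos x ^ (2 * r + 1))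
      ((N + 2 * r + 2 : ℝ) * (Real.sin x ^ N * Real.cos x ^ (2 * (r + 1)))
        - (2 * r + 1) * (Real.sin x ^ N * Real.cos x ^ (2 * r))) x := by
    intro x
    refine (((Real.hasDerivAt_sin x).pow (N + 1)).mul
      ((Real.hasDerivAt_cos x).pow (2 * r + 1))).congr_deriv ?_
    simp only [Nat.add_sub_cancel, Pi.pow_apply]
    push_cast
    have := Real.sin_sq x
    linear_combination (-(2 * r + 1) * Real.sin x ^ N * Real.cos x ^ (2 * r)) * this
  have h := integral_eq_sub_of_hasDerivAt (a := 0) (b := Real.pi) (fun x _ => hd x)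
    (Continuous.intervalIntegrable (by fun_prop) _ _)
  rw [intervalIntegral.integral_sub (Continuous.intervalIntegrable (by fun_prop) _ _)
    (Continuous.intervalIntegrable (by fun_prop) _ _), intervalIntegral.integral_const_mul,
    intervalIntegral.integral_const_mul] at h
  simpa [sub_eq_zero] using h

lemma integral_sin_pow_mul_cos_pow_eq (N r : ℕ) :
    ∫ x in (0 : ℝ)..Real.pi, Real.sin x ^ N * Real.cos x ^ (2 * r)
      = poch (1 / 2) r / poch (((N + 2 : ℕ) : ℝ) / 2) r
        * ∫ x in (0 : ℝ)..Real.pi, Real.sin x ^ N := by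
  induction r with
  | zero => simp [poch_zero]
  | succ r ih =>
    have h := integral_sin_pow_mul_cos_pow_succ N r
    rw [ih] at h
    have h1 := (poch_pos (x := ((N + 2 : ℕ) : ℝ) / 2) (by positivity) r).ne'
    have h2 : (N + 2 * r + 2 : ℝ) ≠ 0 := by positivity
    rw [poch_succ, poch_succ]
    have h3 : (((N + 2 : ℕ) : ℝ) / 2 + r) = (N + 2 * r + 2) / 2 := by push_cast; ring
    rw [h3]
    apply mul_left_cancel₀ h2
    rw [h]
    field_simp
    ring

lemma poch_half_div_poch_le_one (N r : ℕ) :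
    |poch (1 / 2) r / poch (((N + 2 : ℕ) : ℝ) / 2) r| ≤ 1 := by
  have h1 := poch_pos (x := ((N + 2 : ℕ) : ℝ) / 2) (by positivity) r
  have h2 := poch_pos (x := 1 / 2) (by positivity) r
  rw [abs_of_pos (by positivity), div_le_one h1]
  clear h1 h2
  induction r with
  | zero => simp [poch_zero]
  | succ r ih =>
    rw [poch_succ, poch_succ]
    have := poch_pos (x := 1 / 2) (by positivity) r
    gcongr
    · exact poch_pos (by positivity) r |>.le
    · push_cast; linarith [(Nat.cast_nonneg N : (0 : ℝ) ≤ N)]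

/-- Average of `cos (a t cos x)` over `[0, π]` with respect to the weight `sin x ^ N`: the
characteristic function of the uniform law on the sphere of dimension `N + 1`. -/
noncomputable def sphereChar (N : ℕ) (a t : ℝ) : ℝ :=
  (∫ x in (0 : ℝ)..Real.pi, Real.sin x ^ N * Real.cos (a * t * Real.cos x))
    / ∫ x in (0 : ℝ)..Real.pi, Real.sin x ^ N

lemma abs_sphereChar_le_one (N : ℕ) (a t : ℝ) : |sphereChar N a t| ≤ 1 := by
  rw [sphereChar, abs_div, abs_of_pos (integral_sin_pow_pos N), div_le_one (integral_sin_pow_pos N),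
    ← Real.norm_eq_abs]
  refine intervalIntegral.norm_integral_le_of_norm_le Real.pi_pos.le (.of_forall fun x hx => ?_)
    (Continuous.intervalIntegrable (by fun_prop) _ _)
  have hs : 0 ≤ Real.sin x := Real.sin_nonneg_of_nonneg_of_le_pi hx.1.le hx.2
  rw [norm_mul, Real.norm_of_nonneg (by positivity)]
  exact mul_le_of_le_one_right (by positivity) (Real.abs_cos_le_one _)

lemma continuous_sphereChar (N : ℕ) (a : ℝ) : Continuous (sphereChar N a) := by
  refine Continuous.div_const ?_ _
  exact intervalIntegral.continuous_parametric_intervalIntegral_of_continuous' (by fun_prop) _ _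

lemma hasSum_sphereChar (N : ℕ) (a t : ℝ) :
    HasSum (fun r : ℕ => (-1 : ℝ) ^ r * poch (1 / 2) r / poch (((N + 2 : ℕ) : ℝ) / 2) r
      * a ^ (2 * r) / (2 * r).factorial * t ^ (2 * r)) (sphereChar N a t) := by
  have key := intervalIntegral.hasSum_integral_of_dominated_convergence (a := 0) (b := Real.pi)
    (μ := volume) (f := fun x => Real.sin x ^ N * Real.cos (a * t * Real.cos x))
    (F := fun (r : ℕ) (x : ℝ) => Real.sin x ^ N *
      ((-1) ^ r * (a * t * Real.cos x) ^ (2 * r) / (2 * r).factorial))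
    (fun r _ => |a * t| ^ (2 * r) / (2 * r).factorial) ?_ ?_ ?_ ?_ ?_
  · refine Eq.subst (motive := fun F : ℕ → ℝ => HasSum F _) (funext fun r => ?_)
      (key.div_const (∫ x in (0 : ℝ)..Real.pi, Real.sin x ^ N))
    have h : ∀ x : ℝ, Real.sin x ^ N *
        ((-1) ^ r * (a * t * Real.cos x) ^ (2 * r) / (2 * r).factorial)
        = ((-1) ^ r * (a * t) ^ (2 * r) / (2 * r).factorial)
          * (Real.sin x ^ N * Real.cos x ^ (2 * r)) := fun x => by ring
    simp only [h]
    rw [intervalIntegral.integral_const_mul, integral_sin_pow_mul_cos_pow_eq]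
    have := (integral_sin_pow_pos N).ne'
    rw [mul_pow]
    field_simp
  · intro n
    exact (by fun_prop : Continuous _).aestronglyMeasurable
  · refine fun n => .of_forall fun x _ => ?_
    rw [norm_mul, norm_div, norm_mul, norm_pow, norm_pow, norm_pow, norm_neg, norm_one, one_pow,
      one_mul, Real.norm_eq_abs, Real.norm_eq_abs, abs_mul _ (Real.cos x), Real.norm_natCast]
    refine (mul_le_of_le_one_left (by positivity)
      (pow_le_one₀ (abs_nonneg _) (Real.abs_sin_le_one x))).trans ?_
    gcongr
    exact mul_le_of_le_one_right (abs_nonneg _) (Real.abs_cos_le_one x)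
  · refine .of_forall fun x _ => ?_
    exact (Real.summable_pow_div_factorial |a * t|).comp_injective
      (mul_right_injective₀ (two_ne_zero' ℕ))
  · simp
  · refine .of_forall fun x _ => ?_
    exact (Real.hasSum_cos _).mul_left _

lemma integral_exp_mul_cos {p : ℝ} (hp : 0 < p) (b : ℝ) :
    ∫ t in Ioi (0 : ℝ), Real.exp (-p * t) * Real.cos (b * t) = p / (p ^ 2 + b ^ 2) := by
  have hne : p ^ 2 + b ^ 2 ≠ 0 := by positivity
  have hE := integrableOn_exp_mul_Ioi (a := -p) (by linarith) 0
  have hd : ∀ t : ℝ, HasDerivAt (fun t => Real.exp (-p * t)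
      * ((b * Real.sin (b * t) - p * Real.cos (b * t)) / (p ^ 2 + b ^ 2)))
      (Real.exp (-p * t) * Real.cos (b * t)) t := by
    intro t
    have h1 : HasDerivAt (fun t => -p * t) (-p) t := by
      simpa using (hasDerivAt_id t).const_mul (-p)
    have h2 : HasDerivAt (fun t => b * t) b t := by
      simpa using (hasDerivAt_id t).const_mul b
    refine (h1.exp.mul (((h2.sin.const_mul b).sub (h2.cos.const_mul p)).div_const _)).congr_deriv ?_
    simp only [Pi.sub_apply]
    field_simp
    ring
  have hi : IntegrableOn (fun t => Real.exp (-p * t) * Real.cos (b * t)) (Ioi 0) := by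
    refine hE.mono' (by fun_prop) (.of_forall fun t => ?_)
    rw [norm_mul, Real.norm_of_nonneg (Real.exp_nonneg _)]
    exact mul_le_of_le_one_right (Real.exp_nonneg _) (Real.abs_cos_le_one _)
  have ht : Tendsto (fun t => Real.exp (-p * t)
      * ((b * Real.sin (b * t) - p * Real.cos (b * t)) / (p ^ 2 + b ^ 2))) atTop (𝓝 0) := by
    have h0 : Tendsto (fun t => Real.exp (-p * t)) atTop (𝓝 0) :=
      Real.tendsto_exp_atBot.comp (tendsto_id.const_mul_atTop_of_neg (by linarith))
    refine h0.zero_mul_isBoundedUnder_le ⟨(|b| + p) / (p ^ 2 + b ^ 2), ?_⟩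
    rw [eventually_map]
    refine .of_forall fun t => ?_
    simp only [Function.comp, norm_div, Real.norm_eq_abs]
    rw [abs_of_nonneg (by positivity : 0 ≤ p ^ 2 + b ^ 2)]
    gcongr
    refine (abs_sub _ _).trans ?_
    rw [abs_mul, abs_mul, abs_of_pos hp]
    exact add_le_add (mul_le_of_le_one_right (abs_nonneg _) (Real.abs_sin_le_one _))
      (mul_le_of_le_one_right hp.le (Real.abs_cos_le_one _))
  rw [integral_Ioi_of_hasDerivAt_of_tendsto' (fun t _ => hd t) hi ht]
  simp
  ring

lemma laplace_sphereChar (N : ℕ) (a : ℝ) {p : ℝ} (hp : 0 < p) :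
    ∫ t in Ioi (0 : ℝ), Real.exp (-p * t) * sphereChar N a t =
      (∫ x in (0 : ℝ)..Real.pi, Real.sin x ^ N * (p / (p ^ 2 + (a * Real.cos x) ^ 2)))
        / ∫ x in (0 : ℝ)..Real.pi, Real.sin x ^ N := by
  simp only [sphereChar, ← mul_div_assoc]
  rw [MeasureTheory.integral_div]
  congr 1
  simp only [intervalIntegral.integral_of_le Real.pi_pos.le, ← MeasureTheory.integral_const_mul]
  rw [MeasureTheory.integral_integral_swap]
  · refine MeasureTheory.integral_congr_ae (.of_forall fun x => ?_)
    simp only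
    rw [mul_div_assoc, ← integral_exp_mul_cos hp, ← MeasureTheory.integral_const_mul]
    refine MeasureTheory.integral_congr_ae (.of_forall fun t => ?_)
    simp only
    rw [mul_left_comm, mul_right_comm a t]
  · have h := (integrableOn_exp_mul_Ioi (a := -p) (by linarith) 0).mul_prod
      (integrable_const (μ := volume.restrict (Ioc 0 Real.pi)) (1 : ℝ))
    refine h.mono' (Continuous.aestronglyMeasurable ?_) (.of_forall fun z => ?_)
    · simp only [Function.uncurry_def]
      fun_prop
    · simp only [Function.uncurry_def]
      rw [norm_mul, norm_mul, Real.norm_of_nonneg (Real.exp_nonneg _), norm_pow]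
      gcongr
      exact mul_le_one₀ (pow_le_one₀ (abs_nonneg _) (Real.abs_sin_le_one _)) (abs_nonneg _)
        (Real.abs_cos_le_one _)

open PowerSeries in
lemma binomial_sq_coeff {B : PowerSeries ℝ} (h0 : constantCoeff B = 1)
    (hB : ∀ n : ℕ, coeff (n + 1) B * (n + 1) = coeff n B * (1 / 2 + n)) :
    (1 - X) * d⁄dX ℝ B = C (1 / 2) * B ∧ (1 - X) * (B * B) = 1 := by
  have h1 : (1 - X) * d⁄dX ℝ B = C (1 / 2) * B := by
    ext n
    rw [sub_mul, one_mul, map_sub, coeff_C_mul, coeff_derivative, hB]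
    cases n with
    | zero => simp; ring
    | succ n => rw [coeff_succ_X_mul, coeff_derivative]; push_cast; ring
  refine ⟨h1, derivative.ext ?_ (by simp [h0])⟩
  have h2 : C (1 / 2 : ℝ) * 2 = 1 := by
    rw [← map_ofNat (C (R := ℝ)) 2, ← map_mul]; norm_num
  simp only [Derivation.leibniz, smul_eq_mul, map_sub, Derivation.map_one_eq_zero, derivative_X]
  linear_combination (2 * B) * h1 + B * B * h2

open PowerSeries in
lemma binomial_mul_coeff_succ {B F : PowerSeries ℝ} {β : ℝ} (h0 : constantCoeff B = 1)
    (hB : ∀ n : ℕ, coeff (n + 1) B * (n + 1) = coeff n B * (1 / 2 + n))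
    (hF : ∀ n : ℕ, (n + β) * coeff n F = β * coeff n B) (n : ℕ) :
    (n + 1 + β) * coeff (n + 1) (B * F) = (n + β + 1 / 2) * coeff n (B * F) := by
  obtain ⟨h1, h2⟩ := binomial_sq_coeff h0 hB
  have h3 : X * d⁄dX ℝ F + C β * F = C β * B := by
    ext n
    rw [map_add, coeff_C_mul, coeff_C_mul, ← hF]
    cases n with
    | zero => simp
    | succ n => rw [coeff_succ_X_mul, coeff_derivative]; push_cast; ring
  have h4 : (1 - X) * (X * d⁄dX ℝ (B * F) + C β * (B * F)) = X * (C (1 / 2) * (B * F)) + C β := by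
    simp only [Derivation.leibniz, smul_eq_mul]
    linear_combination X * F * h1 + (1 - X) * B * h3 + C β * h2
  have h5 := congrArg (coeff (n + 1)) h4
  simp only [sub_mul, one_mul, map_sub, map_add, coeff_succ_X_mul, coeff_C_mul, coeff_derivative,
    coeff_C, Nat.add_eq_zero_iff, one_ne_zero, and_false, if_false, add_zero] at h5
  cases n with
  | zero => simp at h5 ⊢; linarith
  | succ n =>
    simp only [coeff_succ_X_mul, coeff_derivative] at h5
    push_cast at h5 ⊢
    linarith

lemma summable_norm_mul_pow {u : ℕ → ℝ} (hu : ∀ n, |u n| ≤ 1) {x : ℝ} (hx0 : 0 ≤ x) (hx1 : x < 1) :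
    Summable fun n => ‖u n * x ^ n‖ := by
  refine .of_nonneg_of_le (fun _ => norm_nonneg _) (fun n => ?_)
    (summable_geometric_of_lt_one hx0 hx1)
  rw [norm_mul, norm_pow, Real.norm_of_nonneg hx0]
  exact mul_le_of_le_one_left (by positivity) (hu n)

open PowerSeries in
lemma tsum_coeff_mul {A B : PowerSeries ℝ} (hA : ∀ n, |coeff n A| ≤ 1) (hB : ∀ n, |coeff n B| ≤ 1)
    {x : ℝ} (hx0 : 0 ≤ x) (hx1 : x < 1) :
    (∑' n, coeff n A * x ^ n) * (∑' n, coeff n B * x ^ n) = ∑' n, coeff n (A * B) * x ^ n := by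
  rw [tsum_mul_tsum_eq_tsum_sum_antidiagonal_of_summable_norm (summable_norm_mul_pow hA hx0 hx1)
    (summable_norm_mul_pow hB hx0 hx1)]
  refine tsum_congr fun n => ?_
  rw [coeff_mul, Finset.sum_mul]
  refine Finset.sum_congr rfl fun p hp => ?_
  rw [← Finset.HasAntidiagonal.mem_antidiagonal.1 hp, pow_add]
  ring

/-- The power series of `(1 - x) ^ (-1/2)`. -/
noncomputable def invSqrtSeries : PowerSeries ℝ :=
  PowerSeries.mk fun n => poch (1 / 2) n / n.factorial

/-- The power series of `F(1/2, β; β + 1; x)`. -/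
noncomputable def halfHypSeries (β : ℝ) : PowerSeries ℝ :=
  PowerSeries.mk fun n => (poch (1 / 2) n * poch β n) / (poch (β + 1) n * n.factorial)

lemma invSqrtSeries_coeff_succ (n : ℕ) :
    PowerSeries.coeff (n + 1) invSqrtSeries * (n + 1)
      = PowerSeries.coeff n invSqrtSeries * (1 / 2 + n) := by
  simp only [invSqrtSeries, PowerSeries.coeff_mk, poch_succ, Nat.factorial_succ]
  push_cast
  field_simp

lemma constantCoeff_invSqrtSeries : PowerSeries.constantCoeff invSqrtSeries = 1 := by
  simp [invSqrtSeries, ← PowerSeries.coeff_zero_eq_constantCoeff_apply, poch_zero]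

lemma add_mul_poch (β : ℝ) (n : ℕ) : (n + β) * poch β n = β * poch (β + 1) n := by
  induction n with
  | zero => simp [poch_zero]
  | succ n ih =>
    rw [poch_succ, poch_succ]
    push_cast
    linear_combination (β + 1 + n) * ih

lemma halfHypSeries_coeff {β : ℝ} (hβ : 0 < β) (n : ℕ) :
    (n + β) * PowerSeries.coeff n (halfHypSeries β) = β * PowerSeries.coeff n invSqrtSeries := by
  have h := (poch_pos (x := β + 1) (by positivity) n).ne'
  have h1 := add_mul_poch β n
  simp only [invSqrtSeries, halfHypSeries, PowerSeries.coeff_mk]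
  field_simp
  linear_combination poch (1 / 2) n * h1

lemma invSqrtSeries_coeff_nonneg (n : ℕ) : 0 ≤ PowerSeries.coeff n invSqrtSeries := by
  have := poch_pos (x := 1 / 2) (by positivity) n
  simp only [invSqrtSeries, PowerSeries.coeff_mk]
  positivity

lemma abs_invSqrtSeries_coeff_le (n : ℕ) : |PowerSeries.coeff n invSqrtSeries| ≤ 1 := by
  rw [abs_of_nonneg (invSqrtSeries_coeff_nonneg n)]
  induction n with
  | zero => simp [constantCoeff_invSqrtSeries]
  | succ n ih =>
    have h := invSqrtSeries_coeff_succ n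
    have h0 := invSqrtSeries_coeff_nonneg n
    have : (0 : ℝ) < n + 1 := by positivity
    refine le_of_mul_le_mul_right ?_ this
    rw [h]
    nlinarith

lemma abs_halfHypSeries_coeff_le {β : ℝ} (hβ : 0 < β) (n : ℕ) :
    |PowerSeries.coeff n (halfHypSeries β)| ≤ 1 := by
  have h := congrArg abs (halfHypSeries_coeff hβ n)
  have h1 := abs_invSqrtSeries_coeff_le n
  rw [abs_mul, abs_mul, abs_of_pos hβ, abs_of_pos (by positivity : 0 < n + β)] at h
  refine le_of_mul_le_mul_left ?_ (by positivity : 0 < n + β)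
  rw [h]
  nlinarith [(Nat.cast_nonneg n : (0 : ℝ) ≤ n)]

lemma tsum_invSqrtSeries {x : ℝ} (hx0 : 0 ≤ x) (hx1 : x < 1) :
    ∑' n, PowerSeries.coeff n invSqrtSeries * x ^ n = 1 / Real.sqrt (1 - x) := by
  have hpos : 0 ≤ ∑' n, PowerSeries.coeff n invSqrtSeries * x ^ n :=
    tsum_nonneg fun n => mul_nonneg (invSqrtSeries_coeff_nonneg n) (by positivity)
  have hsq := (binomial_sq_coeff constantCoeff_invSqrtSeries invSqrtSeries_coeff_succ).2
  have hc : ∀ n, PowerSeries.coeff n (invSqrtSeries * invSqrtSeries) = 1 := by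
    intro n
    induction n with
    | zero => simp [constantCoeff_invSqrtSeries]
    | succ n ih =>
      have := congrArg (PowerSeries.coeff (n + 1)) hsq
      rw [sub_mul, one_mul, map_sub, PowerSeries.coeff_succ_X_mul, ih, PowerSeries.coeff_one] at this
      simpa [sub_eq_zero] using this
  have h := tsum_coeff_mul abs_invSqrtSeries_coeff_le abs_invSqrtSeries_coeff_le hx0 hx1
  simp only [hc, one_mul, tsum_geometric_of_lt_one hx0 hx1] at h
  rw [one_div, ← Real.sqrt_inv, ← h, Real.sqrt_mul_self hpos]

lemma integral_sin_pow_add_two_mul {N : ℕ} (hN : 0 < N) (k : ℕ) :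
    ∫ x in (0 : ℝ)..Real.pi, Real.sin x ^ (N + 2 * k)
      = PowerSeries.coeff k (invSqrtSeries * halfHypSeries (N / 2))
        * ∫ x in (0 : ℝ)..Real.pi, Real.sin x ^ N := by
  have hβ : (0 : ℝ) < N / 2 := by positivity
  induction k with
  | zero =>
    have := halfHypSeries_coeff hβ 0
    simp [constantCoeff_invSqrtSeries, hβ.ne'] at this
    simp [constantCoeff_invSqrtSeries, this]
  | succ k ih =>
    have h := binomial_mul_coeff_succ constantCoeff_invSqrtSeries invSqrtSeries_coeff_succ
      (halfHypSeries_coeff hβ) k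
    have h1 : (k + 1 + N / 2 : ℝ) ≠ 0 := by positivity
    apply mul_left_cancel₀ h1
    rw [← mul_assoc, h, mul_assoc, ← ih, show N + 2 * (k + 1) = N + 2 * k + 2 by ring,
      integral_sin_pow]
    simp only [Real.sin_zero, Real.sin_pi, ne_eq, Nat.add_eq_zero_iff, one_ne_zero, and_false,
      not_false_eq_true, zero_pow, zero_mul, sub_self, zero_div, zero_add]
    push_cast
    field_simp
    ring

lemma integral_sin_pow_mul_inv {N : ℕ} (hN : 0 < N) (a : ℝ) {p : ℝ} (hp : 0 < p) :
    (∫ x in (0 : ℝ)..Real.pi, Real.sin x ^ N * (p / (p ^ 2 + (a * Real.cos x) ^ 2)))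
        / (∫ x in (0 : ℝ)..Real.pi, Real.sin x ^ N)
      = hypF (1 / 2) (N / 2) (N / 2 + 1) (a ^ 2 / (p ^ 2 + a ^ 2)) / Real.sqrt (p ^ 2 + a ^ 2) := by
  set y := a ^ 2 / (p ^ 2 + a ^ 2) with hy
  have hβ : (0 : ℝ) < N / 2 := by positivity
  have hS : 0 < p ^ 2 + a ^ 2 := by positivity
  have hy0 : 0 ≤ y := by positivity
  have hy1 : y < 1 := by rw [hy, div_lt_one hS]; linarith [pow_pos hp 2]
  have hle : ∀ x : ℝ, y * Real.sin x ^ 2 ≤ y := fun x =>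
    mul_le_of_le_one_right hy0 (Real.sin_sq_le_one x)
  have hnn : ∀ x : ℝ, 0 ≤ y * Real.sin x ^ 2 := fun x => by positivity
  have key := intervalIntegral.hasSum_integral_of_dominated_convergence (a := 0) (b := Real.pi)
    (μ := volume) (f := fun x => Real.sin x ^ N * (p / (p ^ 2 + (a * Real.cos x) ^ 2)))
    (F := fun (k : ℕ) (x : ℝ) => Real.sin x ^ N * (p / (p ^ 2 + a ^ 2))
      * (y * Real.sin x ^ 2) ^ k)
    (fun k _ => p / (p ^ 2 + a ^ 2) * y ^ k) ?_ ?_ ?_ ?_ ?_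
  · have hk : ∀ k : ℕ, (∫ x in (0 : ℝ)..Real.pi, Real.sin x ^ N * (p / (p ^ 2 + a ^ 2))
        * (y * Real.sin x ^ 2) ^ k) = (p / (p ^ 2 + a ^ 2)) *
          ((PowerSeries.coeff k (invSqrtSeries * halfHypSeries (N / 2)) * y ^ k)
            * ∫ x in (0 : ℝ)..Real.pi, Real.sin x ^ N) := by
      intro k
      rw [mul_right_comm _ (y ^ k), ← integral_sin_pow_add_two_mul hN,
        ← intervalIntegral.integral_mul_const, ← intervalIntegral.integral_const_mul]
      refine intervalIntegral.integral_congr fun x _ => ?_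
      ring
    simp only [hk] at key
    rw [← key.tsum_eq, tsum_mul_left, tsum_mul_right,
      ← tsum_coeff_mul abs_invSqrtSeries_coeff_le (abs_halfHypSeries_coeff_le hβ) hy0 hy1,
      tsum_invSqrtSeries hy0 hy1, mul_div_assoc, mul_div_cancel_right₀ _ (integral_sin_pow_pos N).ne']
    have h1 : 1 - y = p ^ 2 / (p ^ 2 + a ^ 2) := by rw [hy]; field_simp; ring
    have h2 : ∑' n, PowerSeries.coeff n (halfHypSeries (N / 2)) * y ^ n
        = hypF (1 / 2) (N / 2) (N / 2 + 1) y := by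
      simp [hypF, halfHypSeries]
    rw [h1, h2, Real.sqrt_div (by positivity), Real.sqrt_sq hp.le]
    have h3 := Real.sq_sqrt hS.le
    have h4 := Real.sqrt_pos.2 hS
    set q := Real.sqrt (p ^ 2 + a ^ 2)
    rw [← h3]
    field_simp
  · intro n
    exact (by fun_prop : Continuous _).aestronglyMeasurable
  · refine fun n => .of_forall fun x _ => ?_
    rw [norm_mul, norm_mul, norm_pow, norm_pow, Real.norm_of_nonneg (hnn x),
      Real.norm_of_nonneg (by positivity : 0 ≤ p / (p ^ 2 + a ^ 2))]
    refine mul_le_mul (mul_le_of_le_one_left (by positivity)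
      (pow_le_one₀ (abs_nonneg _) (Real.abs_sin_le_one x)))
      (pow_le_pow_left₀ (hnn x) (hle x) n) (by positivity) (by positivity)
  · exact .of_forall fun x _ => (summable_geometric_of_lt_one hy0 hy1).mul_left _
  · simp
  · refine .of_forall fun x _ => ?_
    have h := (hasSum_geometric_of_lt_one (hnn x) ((hle x).trans_lt hy1)).mul_left
      (Real.sin x ^ N * (p / (p ^ 2 + a ^ 2)))
    have hc := Real.cos_sq' x
    have h1 : p ^ 2 + (a * Real.cos x) ^ 2 = (p ^ 2 + a ^ 2) * (1 - y * Real.sin x ^ 2) := by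
      rw [hy, mul_pow, hc]; field_simp; ring
    rw [h1]
    have h2 : 0 < 1 - y * Real.sin x ^ 2 := by linarith [hle x]
    rwa [mul_assoc, ← div_eq_mul_inv, div_div] at h

lemma abs_renewal_seq_le {u v : ℕ → ℝ} {a lam : ℝ} (ha : 0 ≤ a) (hlam : 0 ≤ lam)
    (hv : ∀ n, |v n| ≤ a ^ n) (h0 : u 0 = v 0)
    (hrec : ∀ n, u (n + 1) = v (n + 1)
      + lam * ∑ p ∈ Finset.HasAntidiagonal.antidiagonal n, u p.1 * v p.2) (n : ℕ) :
    |u n| ≤ (a + lam) ^ n := by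
  induction n using Nat.strong_induction_on with
  | _ n ih =>
  cases n with
  | zero => simpa [h0] using hv 0
  | succ n =>
    have hsum : |∑ p ∈ Finset.HasAntidiagonal.antidiagonal n, u p.1 * v p.2|
        ≤ ∑ p ∈ Finset.HasAntidiagonal.antidiagonal n, (a + lam) ^ p.1 * a ^ p.2 := by
      refine (Finset.abs_sum_le_sum_abs _ _).trans (Finset.sum_le_sum fun p hp => ?_)
      have := Finset.HasAntidiagonal.mem_antidiagonal.1 hp
      rw [abs_mul]
      exact mul_le_mul (ih _ (by omega)) (hv _) (abs_nonneg _) (by positivity)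
    have hgeom := geom_sum₂_mul (a + lam) a (n + 1)
    rw [Finset.Nat.sum_antidiagonal_eq_sum_range_succ (fun i j => (a + lam) ^ i * a ^ j)] at hsum
    simp only [Nat.add_sub_cancel, add_sub_cancel_left] at hgeom
    rw [hrec]
    refine (abs_add_le _ _).trans ?_
    rw [abs_mul, abs_of_nonneg hlam]
    have := mul_le_mul_of_nonneg_left hsum hlam
    simp only [Nat.succ_eq_add_one] at this
    linarith [hv (n + 1)]

/-- Theorem 2: the time-series representation
`H(t) = e^{-λt} ∑_{n≥0} γ_{n+1} t^n / n!` converges for all `t ≥ 0` and its Laplace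
transform equals the known Fourier–Laplace transform of the `m`-dimensional symmetric
Markov random flight. -/
theorem stmt9 (m : ℕ) (hm : 3 ≤ m) (c lam a : ℝ) (hc : 0 < c) (hlam : 0 < lam)
    (ha : 0 < a) (θ γ : ℕ → ℝ)
    (hθeven : ∀ r : ℕ, θ (2 * r) = 0)
    (hθodd : ∀ r : ℕ, θ (2 * r + 1)
      = (-1 : ℝ) ^ r * poch (1 / 2) r / poch ((m : ℝ) / 2) r * a ^ (2 * r))
    (hγ1 : γ 1 = 1)
    (hγ : ∀ n : ℕ, 2 ≤ n →
      γ n = θ n + lam * ∑ k ∈ Finset.Icc 1 (n - 1), γ (n - k) * θ k)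
    (H : ℝ → ℝ)
    (hH : ∀ t : ℝ, 0 ≤ t →
      H t = Real.exp (-lam * t) * ∑' n : ℕ, γ (n + 1) / n.factorial * t ^ n) :
    (∀ t : ℝ, 0 ≤ t → Summable (fun n : ℕ => γ (n + 1) / n.factorial * t ^ n)) ∧
    ∀ s : ℝ, 0 < s →
      ∫ t in Set.Ioi (0 : ℝ), Real.exp (-s * t) * H t
        = hypF (1 / 2) (((m : ℝ) - 2) / 2) ((m : ℝ) / 2) (a ^ 2 / ((s + lam) ^ 2 + a ^ 2))
          / (Real.sqrt ((s + lam) ^ 2 + a ^ 2)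
              - lam * hypF (1 / 2) (((m : ℝ) - 2) / 2) ((m : ℝ) / 2)
                  (a ^ 2 / ((s + lam) ^ 2 + a ^ 2))) := by
  obtain ⟨N, rfl⟩ : ∃ N, m = N + 2 := ⟨m - 2, by omega⟩
  have hN : 0 < N := by omega
  have hv : ∀ n, |θ (n + 1)| ≤ a ^ n := by
    intro n
    rcases Nat.even_or_odd' n with ⟨r, rfl | rfl⟩
    · rw [hθodd, mul_div_assoc, abs_mul, abs_mul, abs_pow, abs_neg, abs_one, one_pow, one_mul,
        abs_of_pos (by positivity : 0 < a ^ (2 * r))]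
      exact mul_le_of_le_one_left (by positivity) (poch_half_div_poch_le_one N r)
    · rw [show 2 * r + 1 + 1 = 2 * (r + 1) by ring, hθeven, abs_zero]
      positivity
  have h0 : γ (0 + 1) = θ (0 + 1) := by
    have := hθodd 0
    simp only [poch_zero] at this
    simpa [hγ1] using this.symm
  have hrec : ∀ n, γ (n + 1 + 1) = θ (n + 1 + 1)
      + lam * ∑ p ∈ Finset.HasAntidiagonal.antidiagonal n, γ (p.1 + 1) * θ (p.2 + 1) := by
    intro n
    rw [hγ (n + 1 + 1) (by omega)]
    congr 2
    refine Finset.sum_nbij' (fun k => (n + 1 - k, k - 1)) (fun p => p.2 + 1) ?_ ?_ ?_ ?_ ?_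
    · intro k hk
      rw [Finset.mem_Icc] at hk
      simp only [Finset.HasAntidiagonal.mem_antidiagonal]
      omega
    · intro p hp
      rw [Finset.HasAntidiagonal.mem_antidiagonal] at hp
      simp only [Finset.mem_Icc]
      omega
    · intro k hk
      rw [Finset.mem_Icc] at hk
      simp only
      omega
    · intro p hp
      rw [Finset.HasAntidiagonal.mem_antidiagonal] at hp
      ext <;> simp only <;> omega
    · intro k hk
      rw [Finset.mem_Icc] at hk
      rw [show n + 1 + 1 - k = n + 1 - k + 1 by omega, Nat.sub_add_cancel hk.1]
  have hu : ∀ n, |γ (n + 1)| ≤ (a + lam) ^ n :=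
    abs_renewal_seq_le (u := fun n => γ (n + 1)) (v := fun n => θ (n + 1)) ha.le hlam.le hv h0 hrec
  have hv' : ∀ n, |θ (n + 1)| ≤ (a + lam) ^ n := fun n =>
    (hv n).trans (pow_le_pow_left₀ ha.le (by linarith) n)
  refine ⟨fun t _ => (summable_norm_expGen (u := fun n => γ (n + 1)) hu t).of_norm, fun s hs => ?_⟩
  have hf : expGen (fun n => θ (n + 1)) = sphereChar N a := by
    ext t
    refine HasSum.tsum_eq ?_
    rw [← add_zero (sphereChar N a t)]
    refine HasSum.even_add_odd ?_ ?_
    · simpa only [hθodd] using hasSum_sphereChar N a t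
    · have h2 : ∀ k, θ (2 * k + 1 + 1) = 0 := fun k => hθeven (k + 1)
      simp [h2, hasSum_zero]
  have hren : ∀ t, 0 ≤ t → expGen (fun n => γ (n + 1)) t = sphereChar N a t
      + lam * ∫ τ in (0 : ℝ)..t, expGen (fun n => γ (n + 1)) τ * sphereChar N a (t - τ) := by
    intro t ht
    rw [← hf]
    exact expGen_eq_add_integral hu hv' h0 hrec ht
  have hp : 0 < s + lam := by linarith
  have hL := laplace_renewal (p := s + lam) hlam (by linarith) (continuous_expGen hu)
    (continuous_sphereChar N a) (abs_sphereChar_le_one N a) hren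
  rw [laplace_sphereChar N a hp, integral_sin_pow_mul_inv hN a hp] at hL
  have hHg : ∫ t in Ioi (0 : ℝ), Real.exp (-s * t) * H t
      = ∫ t in Ioi (0 : ℝ), Real.exp (-(s + lam) * t) * expGen (fun n => γ (n + 1)) t := by
    refine setIntegral_congr_fun measurableSet_Ioi fun t ht => ?_
    rw [hH t (le_of_lt ht), ← mul_assoc, ← Real.exp_add, expGen]
    congr 2
    ring
  have hq : 0 < Real.sqrt ((s + lam) ^ 2 + a ^ 2) := Real.sqrt_pos.2 (by positivity)
  have e1 : (((N + 2 : ℕ) : ℝ) - 2) / 2 = N / 2 := by push_cast; ring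
  have e2 : ((N + 2 : ℕ) : ℝ) / 2 = N / 2 + 1 := by push_cast; ring
  rw [hHg, hL, e1, e2, ← mul_div_assoc, one_sub_div hq.ne', div_div_div_cancel_right₀ hq.ne']
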